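/- Let n ≥ 1 be odd, l ∈ R, and let X be the 3-dimensional real Banach space whose unit ball is the prism with vertices (cos((j−1)π/n) ± l, sin((j−1)π/n), ±1) for j = 1, …, 2n. Then the numerical index of X equals sin(π/(2n)). -/

import Mathlib

open Metric Set Real

/-- The numerical radius of a bounded linear operator. -/
noncomputable def nrad {X : Type*} [NormedAddCommGroup X] [NormedSpace ℝ X]
    (T : X →L[ℝ] X) : ℝ :=
  sSup {r : ℝ | ∃ x : X, ∃ f : X →L[ℝ] ℝ, ‖x‖ = 1 ∧ ‖f‖ = 1 ∧ f x = 1 ∧ r = |f (T x)|}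

/-- The numerical index of a normed space. -/
noncomputable def nindex (X : Type*) [NormedAddCommGroup X] [NormedSpace ℝ X] : ℝ :=
  sInf {r : ℝ | ∃ T : X →L[ℝ] X, ‖T‖ = 1 ∧ r = nrad T}

/-- Vertices of the (possibly oblique) prism over the regular 2n-gon:
`(cos((j-1)π/n) ± l, sin((j-1)π/n), ±1)`, `j = 1, …, 2n`. -/
def prismVerts (n : ℕ) (l : ℝ) : Set (Fin 3 → ℝ) :=
  {p | ∃ j : Fin (2 * n),
    p = ![Real.cos (j * π / n) + l, Real.sin (j * π / n), 1] ∨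
    p = ![Real.cos (j * π / n) - l, Real.sin (j * π / n), -1]}

lemma aux_odd_cos (n : ℕ) (hn : 1 ≤ n) (h : ℝ) (hh : 2 * n * h = π) (k : ℤ) :
    |Real.cos ((2 * k + 1) * h)| ≤ Real.cos h := by
  have hn0 : (0:ℤ) < n := by exact_mod_cast hn
  have hnr : (1:ℝ) ≤ n := by exact_mod_cast hn
  have hpos : 0 < h := by
    by_contra hc
    have := Real.pi_pos
    nlinarith
  have h1 : ((2 * k + 1) * h : ℝ) = (2 * ((k % n : ℤ) : ℝ) + 1) * h + ((k / n : ℤ) : ℝ) * π := by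
    have : (k : ℝ) = ((k % n : ℤ) : ℝ) + (n:ℝ) * ((k / n : ℤ) : ℝ) := by
      exact_mod_cast (Int.emod_add_mul_ediv k n).symm
    rw [← hh, this]; ring
  rw [h1, Real.cos_add_int_mul_pi]
  have h2 : |((-1:ℝ) ^ (k / (n:ℤ)))| = 1 := by
    rw [abs_zpow]; simp
  rw [abs_mul, h2, one_mul]
  have a0 : (0:ℝ) ≤ ((k % n : ℤ) : ℝ) := by exact_mod_cast Int.emod_nonneg k hn0.ne'
  have a1 : ((k % n : ℤ) : ℝ) + 1 ≤ n := by exact_mod_cast Int.emod_lt_of_pos k hn0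
  generalize ((k % n : ℤ) : ℝ) = m at *
  rw [abs_le]
  constructor
  · rw [← Real.cos_pi_sub]
    apply Real.cos_le_cos_of_nonneg_of_le_pi
    · nlinarith
    · linarith
    · nlinarith
  · apply Real.cos_le_cos_of_nonneg_of_le_pi
    · linarith
    · nlinarith
    · nlinarith

lemma aux_sin_sum (h A B : ℝ) (h0 : 0 < h) (h1 : h ≤ π / 4) (hAB : A + B = 2 * h) :
    |Real.sin A| + |Real.sin B| ≤ 2 * Real.cos h := by
  have hs : 0 ≤ Real.sin h := (Real.sin_pos_of_pos_of_lt_pi h0 (by linarith [Real.pi_pos])).le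
  have hc : Real.sin h ≤ Real.cos h := by
    rw [← Real.cos_pi_div_two_sub]
    apply Real.cos_le_cos_of_nonneg_of_le_pi <;> linarith [Real.pi_pos]
  obtain ⟨D, rfl, rfl⟩ : ∃ D, A = h + D ∧ B = h - D := ⟨A - h, by ring, by linarith⟩
  rw [Real.sin_add, Real.sin_sub]
  have c1 := Real.abs_cos_le_one D
  have s1 := Real.abs_sin_le_one D
  rw [abs_le] at c1 s1
  rcases abs_cases (Real.sin h * Real.cos D + Real.cos h * Real.sin D) with ⟨e1, _⟩ | ⟨e1, _⟩ <;>
  rcases abs_cases (Real.sin h * Real.cos D - Real.cos h * Real.sin D) with ⟨e2, _⟩ | ⟨e2, _⟩ <;>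
  rw [e1, e2] <;> nlinarith

lemma aux_cos3 (A B p : ℝ) : Real.sin (B - p) * Real.cos A + Real.sin (p - A) * Real.cos B
    = Real.sin (B - A) * Real.cos p := by
  simp only [Real.sin_sub]; ring

lemma aux_sin3 (A B p : ℝ) : Real.sin (B - p) * Real.sin A + Real.sin (p - A) * Real.sin B
    = Real.sin (B - A) * Real.sin p := by
  simp only [Real.sin_sub]; ring

lemma aux_sector (h : ℝ) (h0 : 0 < h) (h1 : h ≤ π / 4) (p q : ℝ) :
    ∃ k : ℤ, ∃ a b : ℝ, 0 ≤ a ∧ 0 ≤ b ∧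
      p = a * Real.cos (2 * k * h) + b * Real.cos (2 * (k + 1) * h) ∧
      q = a * Real.sin (2 * k * h) + b * Real.sin (2 * (k + 1) * h) := by
  have hs : 0 < Real.sin (2 * h) := Real.sin_pos_of_pos_of_lt_pi (by linarith)
    (by linarith [Real.pi_pos])
  obtain ⟨r, φ, hr, rfl, rfl⟩ : ∃ r φ : ℝ, 0 ≤ r ∧ p = r * Real.cos φ ∧ q = r * Real.sin φ :=
    ⟨‖(⟨p, q⟩ : ℂ)‖, Complex.arg ⟨p, q⟩, norm_nonneg _,
      (Complex.norm_mul_cos_arg (⟨p, q⟩ : ℂ)).symm, (Complex.norm_mul_sin_arg (⟨p, q⟩ : ℂ)).symm⟩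
  have k1 := Int.floor_le (φ / (2 * h))
  have k2 := (Int.lt_floor_add_one (φ / (2 * h))).le
  generalize ⌊φ / (2 * h)⌋ = k at *
  rw [le_div_iff₀ (by linarith)] at k1
  rw [div_le_iff₀ (by linarith)] at k2
  have e : 2 * ((k:ℝ) + 1) * h - 2 * k * h = 2 * h := by ring
  have c := aux_cos3 (2 * k * h) (2 * (k + 1) * h) φ
  have s := aux_sin3 (2 * k * h) (2 * (k + 1) * h) φ
  rw [e] at c s
  refine ⟨k, r * Real.sin (2 * (k + 1) * h - φ) / Real.sin (2 * h),
    r * Real.sin (φ - 2 * k * h) / Real.sin (2 * h), ?_, ?_, ?_, ?_⟩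
  · have : 0 ≤ Real.sin (2 * (k + 1) * h - φ) :=
      Real.sin_nonneg_of_nonneg_of_le_pi (by linarith) (by linarith [Real.pi_pos])
    positivity
  · have : 0 ≤ Real.sin (φ - 2 * k * h) :=
      Real.sin_nonneg_of_nonneg_of_le_pi (by linarith) (by linarith [Real.pi_pos])
    positivity
  · field_simp
    linear_combination (-r) * c
  · field_simp
    linear_combination (-r) * s

section core
variable {X : Type*} [NormedAddCommGroup X] [NormedSpace ℝ X]

lemma nrad_bdd (T : X →L[ℝ] X) : BddAbove {r : ℝ | ∃ x : X, ∃ f : X →L[ℝ] ℝ,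
    ‖x‖ = 1 ∧ ‖f‖ = 1 ∧ f x = 1 ∧ r = |f (T x)|} := by
  refine ⟨‖T‖, ?_⟩
  rintro r ⟨x, f, hx, hf, -, rfl⟩
  have h1 := f.le_opNorm (T x)
  have h2 := T.le_opNorm x
  rw [hf, one_mul, Real.norm_eq_abs] at h1
  rw [hx, mul_one] at h2
  linarith

/-- A linear functional bounded by the norm, attaining 1 at a vector of norm at most 1. -/
lemma le_nrad (T : X →L[ℝ] X) (g : X →ₗ[ℝ] ℝ) (hg : ∀ x, |g x| ≤ ‖x‖) (x : X) (hx : ‖x‖ ≤ 1)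
    (hgx : g x = 1) : |g (T x)| ≤ nrad T := by
  have hx1 : ‖x‖ = 1 := le_antisymm hx (by have := hg x; rw [hgx] at this; simpa using this)
  let f : X →L[ℝ] ℝ := g.mkContinuous 1 (fun y => by simpa using hg y)
  have hf : ‖f‖ = 1 := by
    apply le_antisymm
    · exact LinearMap.mkContinuous_norm_le _ zero_le_one _
    · have := f.le_opNorm x
      rw [hx1, mul_one] at this
      have h2 : f x = 1 := hgx
      rw [h2] at this
      simpa using this
  exact le_csSup (nrad_bdd T) ⟨x, f, hx1, hf, hgx, rfl⟩

/-- Vector with given coordinates. -/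
noncomputable def EE (d : X ≃ₗ[ℝ] (Fin 3 → ℝ)) (x y z : ℝ) : X := d.symm ![x, y, z]

lemma EE_comb (d : X ≃ₗ[ℝ] (Fin 3 → ℝ)) (a b c x y z x' y' z' : ℝ) :
    EE d (a * x + b * x') (a * y + b * y') (a * z + b * z' + c) =
      a • EE d x y z + b • EE d x' y' z' + c • EE d 0 0 1 := by
  simp only [EE, ← map_smul, ← map_add]
  congr 1
  ext i; fin_cases i <;> simp

lemma EE_norm (d : X ≃ₗ[ℝ] (Fin 3 → ℝ)) (h : ℝ) (n : ℕ) (hh : 2 * n * h = π)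
    (hA : ∀ (k : ℤ) (z : ℝ), |z| = 1 →
      ‖EE d (Real.cos (2 * k * h)) (Real.sin (2 * k * h)) z‖ ≤ 1)
    (k : ℤ) (a b C z : ℝ) (ha : 0 ≤ a) (hb : 0 ≤ b) (hab : a + b ≤ C) (hz : |z| ≤ C) :
    ‖EE d (a * Real.cos (2 * k * h) + b * Real.cos (2 * (k + 1) * h))
      (a * Real.sin (2 * k * h) + b * Real.sin (2 * (k + 1) * h)) z‖ ≤ C := by
  have hC : 0 ≤ C := by linarith
  have e3 : ‖EE d 0 0 1‖ ≤ 1 := by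
    have h1 := hA 0 1 (by simp)
    have h2 := hA n 1 (by simp)
    have e : EE d 0 0 1 = (1/2:ℝ) • EE d (Real.cos (2 * (0:ℤ) * h)) (Real.sin (2 * (0:ℤ) * h)) 1
       + (1/2:ℝ) • EE d (Real.cos (2 * (n:ℤ) * h)) (Real.sin (2 * (n:ℤ) * h)) 1
       + (0:ℝ) • EE d 0 0 1 := by
      rw [← EE_comb]
      simp [hh]
      norm_num
    rw [e, zero_smul, add_zero]
    refine (norm_add_le _ _).trans ?_
    rw [norm_smul, norm_smul]
    norm_num at h1 h2 ⊢
    linarith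
  have key : ∀ σ : ℝ, |σ| = 1 →
    ‖EE d (a * Real.cos (2 * k * h) + b * Real.cos (2 * (k + 1) * h))
      (a * Real.sin (2 * k * h) + b * Real.sin (2 * (k + 1) * h)) (σ * C)‖ ≤ C := by
    intro σ hσ
    have h1 := hA k σ hσ
    have h2 := hA (k+1) σ hσ
    have e : σ * C = a * σ + b * σ + (C - a - b) * σ := by ring
    rw [e, EE_comb]
    push_cast at h2
    refine (norm_add_le _ _).trans ?_
    have := norm_add_le (a • EE d (Real.cos (2 * k * h)) (Real.sin (2 * k * h)) σ)
      (b • EE d (Real.cos (2 * (k+1) * h)) (Real.sin (2 * (k+1) * h)) σ)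
    rw [norm_smul, norm_smul] at this
    rw [norm_smul, norm_mul]
    rw [Real.norm_eq_abs, Real.norm_eq_abs, abs_of_nonneg ha, abs_of_nonneg hb] at this
    rw [Real.norm_eq_abs, Real.norm_eq_abs, abs_of_nonneg (by linarith : 0 ≤ C - a - b), hσ]
    nlinarith
  rcases hC.eq_or_lt with hC0 | hC0
  · have : z = 1 * C := by
      rw [← hC0] at hz ⊢
      have := abs_nonpos_iff.1 hz
      simp [this]
    rw [this]; exact key 1 (by simp)
  · have k1 := key 1 (by simp)
    have k2 := key (-1) (by simp)
    generalize (a * Real.cos (2 * k * h) + b * Real.cos (2 * (k + 1) * h)) = p at *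
    generalize (a * Real.sin (2 * k * h) + b * Real.sin (2 * (k + 1) * h)) = q at *
    rw [abs_le] at hz
    set w := (1 + z / C) / 2 with hw
    have w1 : z / C ≤ 1 := by rw [div_le_one hC0]; exact hz.2
    have w2 : -1 ≤ z / C := by rw [le_div_iff₀ hC0]; linarith
    have e : EE d p q z = w • EE d p q (1 * C) + (1 - w) • EE d p q (-1 * C)
        + (0:ℝ) • EE d 0 0 1 := by
      rw [← EE_comb]
      congr 1
      · ring
      · ring
      · rw [hw]; field_simp; ring
    rw [e, zero_smul, add_zero]
    refine (norm_add_le _ _).trans ?_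
    rw [norm_smul, norm_smul, Real.norm_eq_abs, Real.norm_eq_abs,
      abs_of_nonneg (by linarith : 0 ≤ w), abs_of_nonneg (by linarith : 0 ≤ 1 - w)]
    nlinarith

/-- The linear functional with coefficients `a, b, c`. -/
noncomputable def LL (d : X ≃ₗ[ℝ] (Fin 3 → ℝ)) (a b c : ℝ) : X →ₗ[ℝ] ℝ where
  toFun x := a * d x 0 + b * d x 1 + c * d x 2
  map_add' x y := by simp; ring
  map_smul' r x := by simp; ring

lemma LL_EE (d : X ≃ₗ[ℝ] (Fin 3 → ℝ)) (a b c x y z : ℝ) :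
    LL d a b c (EE d x y z) = a * x + b * y + c * z := by
  simp [LL, EE]

lemma EE_coord (d : X ≃ₗ[ℝ] (Fin 3 → ℝ)) (x : X) : EE d (d x 0) (d x 1) (d x 2) = x := by
  rw [EE, LinearEquiv.symm_apply_eq]
  ext i; fin_cases i <;> simp

/-- Rotation of the first two coordinates. -/
noncomputable def RR (d : X ≃ₗ[ℝ] (Fin 3 → ℝ)) (c : ℝ) : X →ₗ[ℝ] X where
  toFun x := EE d (-c * d x 1) (c * d x 0) 0
  map_add' x y := by
    simp only [EE, ← map_add]; congr 1; ext i; fin_cases i <;> simp <;> ring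
  map_smul' r x := by
    simp only [EE, ← map_smul]; congr 1; ext i; fin_cases i <;> simp <;> ring

lemma core_lower (d : X ≃ₗ[ℝ] (Fin 3 → ℝ)) (h : ℝ) (n : ℕ) (hn : 3 ≤ n) (hh : 2 * n * h = π)
    (hA : ∀ (k : ℤ) (z : ℝ), |z| = 1 →
      ‖EE d (Real.cos (2 * k * h)) (Real.sin (2 * k * h)) z‖ ≤ 1)
    (hB : ∀ (S : X →ₗ[ℝ] ℝ) (C : ℝ), (∀ (k : ℤ) (z : ℝ), |z| = 1 →
      |S (EE d (Real.cos (2 * k * h)) (Real.sin (2 * k * h)) z)| ≤ C) → ∀ x, |S x| ≤ C * ‖x‖)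
    (hB' : ∀ (S : X →ₗ[ℝ] X) (C : ℝ), (∀ (k : ℤ) (z : ℝ), |z| = 1 →
      ‖S (EE d (Real.cos (2 * k * h)) (Real.sin (2 * k * h)) z)‖ ≤ C) → ∀ x, ‖S x‖ ≤ C * ‖x‖)
    (T : X →L[ℝ] X) (hT : ‖T‖ = 1) : Real.sin h ≤ nrad T := by
  have hnr : (3:ℝ) ≤ n := by exact_mod_cast hn
  have h0 : 0 < h := by
    by_contra hc
    have := Real.pi_pos
    nlinarith
  have h1 : h ≤ π / 4 := by nlinarith
  have hs : 0 < Real.sin h := Real.sin_pos_of_pos_of_lt_pi h0 (by linarith [Real.pi_pos])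
  have hc : 0 < Real.cos h := Real.cos_pos_of_mem_Ioo ⟨by linarith [Real.pi_pos],
    by linarith [Real.pi_pos]⟩
  have hs1 : Real.sin h ≤ 1 := Real.sin_le_one h
  have hν : 0 ≤ nrad T := by
    apply Real.sSup_nonneg
    rintro r ⟨x, f, -, -, -, rfl⟩
    positivity
  set ν := nrad T with hνd
  have hνs : ν ≤ ν / Real.sin h := by
    rw [le_div_iff₀ hs]; nlinarith
  have main : ∀ (k : ℤ) (z : ℝ), |z| = 1 →
      ‖T (EE d (Real.cos (2 * k * h)) (Real.sin (2 * k * h)) z)‖ ≤ ν / Real.sin h := by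
    intro j σ hσ
    set V := EE d (Real.cos (2 * j * h)) (Real.sin (2 * j * h)) σ with hV
    have hσ2 : σ * σ = 1 := by
      have := abs_mul_abs_self σ; rw [hσ] at this; linarith
    rw [← EE_coord d (T V)]
    obtain ⟨k, a, b, ha, hb, hp, hq⟩ := aux_sector h h0 h1 (d (T V) 0) (d (T V) 1)
    -- facet functional
    set β := (2 * (k:ℝ) + 1) * h with hβ
    set g := LL d (Real.cos β / Real.cos h) (Real.sin β / Real.cos h) 0 with hg
    have gE : ∀ φ z, g (EE d (Real.cos φ) (Real.sin φ) z) = Real.cos (β - φ) / Real.cos h := by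
      intro φ z
      rw [hg, LL_EE, Real.cos_sub]; ring
    have gbound : ∀ x, |g x| ≤ ‖x‖ := by
      intro x
      have := hB g 1 (by
        intro i z _
        rw [gE, abs_div, abs_of_pos hc, div_le_one hc]
        have := aux_odd_cos n (by omega) h hh (k - i)
        have e : β - 2 * i * h = (2 * ((k - i : ℤ) : ℝ) + 1) * h := by
          rw [hβ]; push_cast; ring
        rw [e]; exact this) x
      linarith
    have g1 : ∀ z, g (EE d (Real.cos (2 * k * h)) (Real.sin (2 * k * h)) z) = 1 := by
      intro z
      rw [gE, hβ, show (2 * (k:ℝ) + 1) * h - 2 * k * h = h by ring, div_self hc.ne']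
    have g2 : ∀ z, g (EE d (Real.cos (2 * (k+1) * h)) (Real.sin (2 * (k+1) * h)) z) = 1 := by
      intro z
      rw [gE, hβ, show (2 * (k:ℝ) + 1) * h - 2 * (k+1) * h = -h by ring, Real.cos_neg,
        div_self hc.ne']
    have gTV : g (T V) = a + b := by
      have e1 := EE_comb d a b (d (T V) 2) (Real.cos (2 * k * h)) (Real.sin (2 * k * h)) 0
        (Real.cos (2 * (k+1) * h)) (Real.sin (2 * (k+1) * h)) 0
      rw [← hp, ← hq, mul_zero, mul_zero, add_zero, zero_add, EE_coord] at e1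
      have e3 : g (EE d 0 0 1) = 0 := by rw [hg, LL_EE]; ring
      calc g (T V) = g (a • EE d (Real.cos (2 * k * h)) (Real.sin (2 * k * h)) 0 +
        b • EE d (Real.cos (2 * (k+1) * h)) (Real.sin (2 * (k+1) * h)) 0 +
          d (T V) 2 • EE d 0 0 1) := by rw [← e1]
        _ = a + b := by
          rw [map_add, map_add, map_smul, map_smul, map_smul, g1, g2, e3]; simp
    rw [hp, hq]
    apply EE_norm d h n hh hA k a b _ _ ha hb
    · -- facet
      set G : X →ₗ[ℝ] ℝ := g.comp (T : X →ₗ[ℝ] X) with hG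
      have GT : ∀ x, G x = g (T x) := fun x => rfl
      set A := G (EE d (Real.cos (2 * k * h)) (Real.sin (2 * k * h)) 0) with hAA
      set B := G (EE d (Real.cos (2 * (k+1) * h)) (Real.sin (2 * (k+1) * h)) 0) with hBB
      set D := G (EE d 0 0 1) with hDD
      have comb : ∀ x y z, EE d x y z = (1:ℝ) • EE d x y 0 + (0:ℝ) • EE d 0 0 0 + z • EE d 0 0 1 := by
        intro x y z
        rw [← EE_comb]; simp
      have b1 : ∀ z, |z| = 1 → |A + z * D| ≤ ν := by
        intro z hz
        have := le_nrad T g gbound _ (hA k z hz) (g1 z)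
        rw [← GT, comb, map_add, map_add, map_smul, map_smul, map_smul] at this
        simpa using this
      have b2 : ∀ z, |z| = 1 → |B + z * D| ≤ ν := by
        intro z hz
        have hA2 := hA (k+1) z hz
        push_cast at hA2
        have := le_nrad T g gbound _ hA2 (g2 z)
        rw [← GT, comb, map_add, map_add, map_smul, map_smul, map_smul] at this
        simpa using this
      have c1 : |A| ≤ ν - |D| := by
        have p1 := b1 1 (by simp)
        have p2 := b1 (-1) (by simp)
        rw [abs_le] at p1 p2
        rcases abs_cases A with ⟨e, _⟩ | ⟨e, _⟩ <;> rcases abs_cases D with ⟨e', _⟩ | ⟨e', _⟩ <;>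
          rw [e, e'] <;> linarith
      have c2 : |B| ≤ ν - |D| := by
        have p1 := b2 1 (by simp)
        have p2 := b2 (-1) (by simp)
        rw [abs_le] at p1 p2
        rcases abs_cases B with ⟨e, _⟩ | ⟨e, _⟩ <;> rcases abs_cases D with ⟨e', _⟩ | ⟨e', _⟩ <;>
          rw [e, e'] <;> linarith
      have hS := aux_sin_sum h (2 * (k+1) * h - 2 * j * h) (2 * j * h - 2 * k * h) h0 h1 (by ring)
      have t1 := aux_cos3 (2 * k * h) (2 * (k+1) * h) (2 * j * h)
      have t2 := aux_sin3 (2 * k * h) (2 * (k+1) * h) (2 * j * h)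
      rw [show 2 * ((k:ℝ)+1) * h - 2 * k * h = 2 * h by ring, Real.sin_two_mul] at t1 t2
      generalize Real.sin (2 * (k+1) * h - 2 * j * h) = P at *
      generalize Real.sin (2 * j * h - 2 * k * h) = Q at *
      have e2 : (2 * Real.sin h * Real.cos h) • V =
          P • EE d (Real.cos (2 * k * h)) (Real.sin (2 * k * h)) 0 +
          Q • EE d (Real.cos (2 * (k+1) * h)) (Real.sin (2 * (k+1) * h)) 0 +
          (2 * Real.sin h * Real.cos h * σ) • EE d 0 0 1 := by
        rw [← EE_comb, t1, t2, hV]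
        simp only [EE, ← map_smul]
        congr 1
        ext i; fin_cases i <;> simp
      have e3 : (2 * Real.sin h * Real.cos h) * (a + b) =
          P * A + Q * B + 2 * Real.sin h * Real.cos h * σ * D := by
        have := congrArg G e2
        rw [map_add, map_add, map_smul, map_smul, map_smul, map_smul, GT V, gTV] at this
        simpa using this
      rw [le_div_iff₀ hs]
      have f1 : P * A ≤ |P| * (ν - |D|) :=
        (le_abs_self _).trans (by rw [abs_mul]; gcongr)
      have f2 : Q * B ≤ |Q| * (ν - |D|) :=
        (le_abs_self _).trans (by rw [abs_mul]; gcongr)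
      have f3 : σ * D ≤ |D| := (le_abs_self _).trans (by rw [abs_mul, hσ, one_mul])
      have f4 : (|P| + |Q|) * (ν - |D|) ≤ 2 * Real.cos h * (ν - |D|) := by
        gcongr
        exact (abs_nonneg _).trans c1
      have f5 : 2 * Real.sin h * Real.cos h * (σ * D) ≤ 2 * Real.cos h * |D| := by
        have : 2 * Real.sin h * Real.cos h * (σ * D) ≤ 2 * Real.sin h * Real.cos h * |D| := by
          gcongr
        have : 2 * Real.sin h * Real.cos h * |D| ≤ 2 * 1 * Real.cos h * |D| := by
          gcongr
        linarith
      have f6 : (2 * Real.cos h) * ((a + b) * Real.sin h) ≤ (2 * Real.cos h) * ν := by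
        nlinarith
      exact le_of_mul_le_mul_left f6 (by positivity)
    · -- z
      have hb3 : ∀ x, |LL d 0 0 σ x| ≤ ‖x‖ := by
        intro x
        have := hB (LL d 0 0 σ) 1 (by
          intro i z hz
          rw [LL_EE]; simp [abs_mul, hz, hσ]) x
        linarith
      have := le_nrad T (LL d 0 0 σ) hb3 V (hA j σ hσ) (by rw [hV, LL_EE]; linarith)
      refine le_trans ?_ hνs
      refine le_trans ?_ this
      simp [LL, abs_mul, hσ]
  have := T.opNorm_le_bound (div_nonneg hν hs.le) (hB' (T : X →ₗ[ℝ] X) _ main)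
  rw [hT, le_div_iff₀ hs] at this
  linarith

lemma core_upper (d : X ≃ₗ[ℝ] (Fin 3 → ℝ)) (h : ℝ) (n : ℕ) (hn : 3 ≤ n) (hodd : Odd n)
    (hh : 2 * n * h = π)
    (hA : ∀ (k : ℤ) (z : ℝ), |z| = 1 →
      ‖EE d (Real.cos (2 * k * h)) (Real.sin (2 * k * h)) z‖ ≤ 1)
    (hB : ∀ (S : X →ₗ[ℝ] ℝ) (C : ℝ), (∀ (k : ℤ) (z : ℝ), |z| = 1 →
      |S (EE d (Real.cos (2 * k * h)) (Real.sin (2 * k * h)) z)| ≤ C) → ∀ x, |S x| ≤ C * ‖x‖)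
    (hB' : ∀ (S : X →ₗ[ℝ] X) (C : ℝ), (∀ (k : ℤ) (z : ℝ), |z| = 1 →
      ‖S (EE d (Real.cos (2 * k * h)) (Real.sin (2 * k * h)) z)‖ ≤ C) → ∀ x, ‖S x‖ ≤ C * ‖x‖) :
    ∃ T : X →L[ℝ] X, ‖T‖ = 1 ∧ nrad T ≤ Real.sin h := by
  have hnr : (3:ℝ) ≤ n := by exact_mod_cast hn
  have h0 : 0 < h := by
    by_contra hc
    have := Real.pi_pos
    nlinarith
  have h1 : h ≤ π / 4 := by nlinarith
  have hs : 0 < Real.sin h := Real.sin_pos_of_pos_of_lt_pi h0 (by linarith [Real.pi_pos])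
  have hc : 0 < Real.cos h := Real.cos_pos_of_mem_Ioo ⟨by linarith [Real.pi_pos],
    by linarith [Real.pi_pos]⟩
  have hs1 : Real.sin h ≤ 1 := Real.sin_le_one h
  have hsq := Real.sin_sq_add_cos_sq h
  set s := Real.sin h with hsd
  set c := Real.cos h with hcd
  have R_EE : ∀ x y z, RR d c (EE d x y z) = EE d (-c * y) (c * x) 0 := by
    intro x y z; simp [RR, EE]
  have c2 : Real.cos (2 * h) = 1 - 2 * s ^ 2 := by rw [Real.cos_two_mul]; linarith
  have s2 : Real.sin (2 * h) = 2 * s * c := Real.sin_two_mul h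
  -- the key estimate, with step `s`
  have key : ∀ ε : ℝ, |ε| = 1 → ∀ x, ‖x + (ε * s) • RR d c x‖ ≤ (1 + s * s) * ‖x‖ := by
    intro ε hε
    have hε' : ε = 1 ∨ ε = -1 := eq_or_eq_neg_of_abs_eq hε
    refine hB' (LinearMap.id + (ε * s) • RR d c) _ ?_
    intro k z hz
    have hs2 : s ^ 2 ≤ 1 := by nlinarith
    have e0 : (LinearMap.id + (ε * s) • RR d c : X →ₗ[ℝ] X)
        (EE d (Real.cos (2 * k * h)) (Real.sin (2 * k * h)) z) =
        EE d (Real.cos (2 * k * h) - ε * s * c * Real.sin (2 * k * h))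
          (Real.sin (2 * k * h) + ε * s * c * Real.cos (2 * k * h)) z := by
      simp only [LinearMap.add_apply, LinearMap.id_apply, LinearMap.smul_apply, R_EE]
      simp only [EE, ← map_smul, ← map_add]
      congr 1
      ext i; fin_cases i <;> simp <;> ring
    rw [e0]
    have hzz : |z| ≤ 1 + s * s := by rw [hz]; nlinarith
    rcases hε' with rfl | rfl
    · have := EE_norm d h n hh hA k (1/2 + s^2) (1/2) (1 + s * s) z (by positivity) (by positivity)
        (by nlinarith) hzz
      convert this using 2
      rw [show 2 * ((k:ℝ)+1) * h = 2 * k * h + 2 * h by ring, Real.cos_add, Real.sin_add, c2, s2]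
      congr 1 <;> ring
    · have := EE_norm d h n hh hA (k-1) (1/2) (1/2 + s^2) (1 + s * s) z (by positivity)
        (by positivity) (by nlinarith) hzz
      convert this using 2
      push_cast
      rw [show 2 * ((k:ℝ)-1) * h = 2 * k * h - 2 * h by ring,
        show 2 * ((k:ℝ)-1+1) * h = 2 * k * h by ring, Real.cos_sub, Real.sin_sub, c2, s2]
      congr 1 <;> ring
  -- continuity
  have hcont : ∃ C, ∀ x, ‖RR d c x‖ ≤ C * ‖x‖ := by
    refine ⟨(1 + s * s + 1) / s, fun x => ?_⟩
    have k1 := key 1 (by simp) x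
    have k2 : ‖(1 * s) • RR d c x‖ ≤ ‖x + (1 * s) • RR d c x‖ + ‖x‖ := by
      have := norm_sub_le (x + (1 * s) • RR d c x) x
      rwa [add_sub_cancel_left] at this
    rw [norm_smul, one_mul, Real.norm_eq_abs, abs_of_pos hs] at k2
    rw [one_mul] at k1
    rw [div_mul_eq_mul_div, le_div_iff₀ hs]
    linarith
  obtain ⟨C, hC⟩ := hcont
  set T0 : X →L[ℝ] X := (RR d c).mkContinuous C hC with hT0
  have T0_apply : ∀ x, T0 x = RR d c x := fun x => rfl
  have norm1 : 1 ≤ ‖T0‖ := by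
    have e := hA 0 1 (by simp)
    have hb : ∀ x, |LL d 0 (1/c) 0 x| ≤ ‖x‖ := by
      intro x
      have := hB (LL d 0 (1/c) 0) 1 (by
        intro i z _
        rw [LL_EE]
        obtain ⟨m, hm⟩ := hodd
        have := aux_odd_cos n (by omega) h hh (m - i)
        have e : (2 * ((m - i : ℤ):ℝ) + 1) * h = π / 2 - 2 * i * h := by
          rw [← hh, hm]; push_cast; ring
        rw [e, Real.cos_pi_div_two_sub] at this
        rw [zero_mul, zero_mul, zero_add, add_zero, abs_mul, abs_of_pos (by positivity)]
        rw [one_div, inv_mul_le_iff₀ hc, mul_one]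
        exact this) x
      linarith
    have e1 := hb (T0 (EE d (Real.cos (2 * (0:ℤ) * h)) (Real.sin (2 * (0:ℤ) * h)) 1))
    have e2 := T0.le_opNorm (EE d (Real.cos (2 * (0:ℤ) * h)) (Real.sin (2 * (0:ℤ) * h)) 1)
    have e3 : LL d 0 (1/c) 0 (T0 (EE d (Real.cos (2 * (0:ℤ) * h)) (Real.sin (2 * (0:ℤ) * h)) 1))
        = 1 := by
      rw [T0_apply, R_EE, LL_EE]
      simp [hc.ne']
    rw [e3, abs_one] at e1
    have := norm_nonneg T0
    nlinarith
  have hpos : 0 < ‖T0‖ := by linarith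
  refine ⟨‖T0‖⁻¹ • T0, ?_, ?_⟩
  · rw [norm_smul, norm_inv, norm_norm, inv_mul_cancel₀ hpos.ne']
  · apply Real.sSup_le _ hs.le
    rintro r ⟨x, f, hx, hf, hfx, rfl⟩
    have b : ∀ ε : ℝ, |ε| = 1 → ε * f (T0 x) ≤ s := by
      intro ε hε
      have k := key ε hε x
      rw [hx, mul_one] at k
      have l := (le_abs_self _).trans (f.le_opNorm (x + (ε * s) • RR d c x))
      rw [hf, one_mul, map_add, map_smul, hfx, ← T0_apply, smul_eq_mul] at l
      rw [← T0_apply] at k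
      have : s * (ε * f (T0 x)) ≤ s * s := by linarith
      exact le_of_mul_le_mul_left this hs
    have b1 := b 1 (by simp)
    have b2 := b (-1) (by simp)
    have b3 : |f (T0 x)| ≤ s := by rw [abs_le]; constructor <;> linarith
    have : f ((‖T0‖⁻¹ • T0) x) = ‖T0‖⁻¹ * f (T0 x) := by simp
    rw [this, abs_mul, abs_of_pos (inv_pos.2 hpos)]
    rw [inv_mul_le_iff₀ hpos]
    nlinarith

lemma hull_bound {Y : Type*} [NormedAddCommGroup Y] [NormedSpace ℝ Y]
    (e : X ≃ₗ[ℝ] (Fin 3 → ℝ)) (s : Set (Fin 3 → ℝ))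
    (hball : closedBall (0 : X) 1 = e ⁻¹' (convexHull ℝ s)) (S : X →ₗ[ℝ] Y) (C : ℝ)
    (hS : ∀ v ∈ s, ‖S (e.symm v)‖ ≤ C) (x : X) : ‖S x‖ ≤ C * ‖x‖ := by
  have h1 : convexHull ℝ s ⊆ (S.comp (e.symm : (Fin 3 → ℝ) →ₗ[ℝ] X)) ⁻¹' closedBall 0 C := by
    apply convexHull_min
    · intro v hv; simpa using hS v hv
    · exact (convex_closedBall _ _).linear_preimage _
  rcases eq_or_ne x 0 with rfl | hx
  · simp
  have hx' : 0 < ‖x‖ := norm_pos_iff.2 hx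
  have h2 : ‖x‖⁻¹ • x ∈ closedBall (0:X) 1 := by
    simp [norm_smul, hx'.ne']
  rw [hball] at h2
  have h3 := h1 h2
  simp only [mem_preimage, LinearMap.comp_apply, LinearEquiv.coe_coe,
    LinearEquiv.symm_apply_apply, mem_closedBall_zero_iff, map_smul, norm_smul, norm_inv,
    norm_norm] at h3
  rw [inv_mul_le_iff₀ hx'] at h3
  linarith

/-- The shear straightening the prism. -/
noncomputable def shear (l : ℝ) : (Fin 3 → ℝ) ≃ₗ[ℝ] (Fin 3 → ℝ) where
  toFun v := ![v 0 - l * v 2, v 1, v 2]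
  invFun v := ![v 0 + l * v 2, v 1, v 2]
  map_add' u v := by ext i; fin_cases i <;> simp; ring
  map_smul' r v := by ext i; fin_cases i <;> simp; ring
  left_inv v := by ext i; fin_cases i <;> simp
  right_inv v := by ext i; fin_cases i <;> simp

lemma shear_EE (e : X ≃ₗ[ℝ] (Fin 3 → ℝ)) (l x y z : ℝ) :
    EE (e.trans (shear l)) x y z = e.symm ![x + l * z, y, z] := by
  rfl

end core

theorem stmt_7 {X : Type*} [NormedAddCommGroup X] [NormedSpace ℝ X]
    (n : ℕ) (hn : 1 ≤ n) (hodd : Odd n) (l : ℝ)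
    (e : X ≃ₗ[ℝ] (Fin 3 → ℝ))
    (hball : closedBall (0 : X) 1 = e ⁻¹' (convexHull ℝ (prismVerts n l))) :
    nindex X = Real.sin (π / (2 * n)) := by
  have hn0 : (n:ℝ) ≠ 0 := by positivity
  rcases Nat.lt_or_ge n 3 with hlt | hn3
  · exfalso
    have h1 : n = 1 := by
      obtain ⟨m, rfl⟩ := hodd
      omega
    subst h1
    have := hull_bound e _ hball (LL e 0 1 0) 0 (by
      rintro v ⟨j, hv | hv⟩ <;> subst hv
      · have := LL_EE e 0 1 0 (Real.cos (j * π / (1:ℕ)) + l) (Real.sin (j * π / (1:ℕ))) 1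
        rw [EE] at this
        rw [this]; simp [Real.sin_nat_mul_pi]
      · have := LL_EE e 0 1 0 (Real.cos (j * π / (1:ℕ)) - l) (Real.sin (j * π / (1:ℕ))) (-1)
        rw [EE] at this
        rw [this]; simp [Real.sin_nat_mul_pi]) (EE e 0 1 0)
    rw [LL_EE] at this
    norm_num at this
  set h := π / (2 * n) with hdef
  have hh : 2 * n * h = π := by rw [hdef]; field_simp
  have ang : ∀ j : ℝ, j * π / n = 2 * j * h := by intro j; rw [hdef]; field_simp
  set d := e.trans (shear l) with hd
  have hA : ∀ (k : ℤ) (z : ℝ), |z| = 1 →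
      ‖EE d (Real.cos (2 * k * h)) (Real.sin (2 * k * h)) z‖ ≤ 1 := by
    intro k z hz
    have hN : (0:ℤ) < 2 * n := by positivity
    have r0 := Int.emod_nonneg k hN.ne'
    have r1 := Int.emod_lt_of_pos k hN
    obtain ⟨j, hj⟩ := Int.eq_ofNat_of_zero_le r0
    have hk : (k:ℝ) = j + 2 * n * ((k / (2 * n) : ℤ) : ℝ) := by
      have := (Int.emod_add_mul_ediv k (2 * n)).symm
      rw [hj] at this
      exact_mod_cast this
    have hang : 2 * (k:ℝ) * h = 2 * j * h + ((k / (2 * n) : ℤ) : ℝ) * (2 * π) := by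
      rw [← hh, hk]; push_cast; ring
    rw [hang, Real.cos_add_int_mul_two_pi, Real.sin_add_int_mul_two_pi, ← ang, hd, shear_EE]
    rw [← mem_closedBall_zero_iff, hball, mem_preimage, LinearEquiv.apply_symm_apply]
    apply subset_convexHull
    refine ⟨⟨j, by omega⟩, ?_⟩
    rcases eq_or_eq_neg_of_abs_eq hz with rfl | rfl
    · left; simp
    · right; simp [sub_eq_add_neg]
  have hB : ∀ (Y : Type _) [NormedAddCommGroup Y] [NormedSpace ℝ Y] (S : X →ₗ[ℝ] Y) (C : ℝ),
      (∀ (k : ℤ) (z : ℝ), |z| = 1 →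
      ‖S (EE d (Real.cos (2 * k * h)) (Real.sin (2 * k * h)) z)‖ ≤ C) →
      ∀ x, ‖S x‖ ≤ C * ‖x‖ := by
    intro Y _ _ S C hS
    apply hull_bound e _ hball
    rintro v ⟨j, hv | hv⟩ <;> subst hv
    · have := hS j 1 (by simp)
      rw [hd, shear_EE] at this
      rw [ang]
      simpa using this
    · have := hS j (-1) (by simp)
      rw [hd, shear_EE] at this
      rw [ang]
      simpa [sub_eq_add_neg] using this
  have hB1 : ∀ (S : X →ₗ[ℝ] ℝ) (C : ℝ),
      (∀ (k : ℤ) (z : ℝ), |z| = 1 →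
      |S (EE d (Real.cos (2 * k * h)) (Real.sin (2 * k * h)) z)| ≤ C) →
      ∀ x, |S x| ≤ C * ‖x‖ := by
    intro S C hS
    refine hull_bound e _ hball S C ?_
    rintro v ⟨j, hv | hv⟩ <;> subst hv
    · have := hS j 1 (by simp)
      rw [hd, shear_EE] at this
      rw [ang]
      simpa using this
    · have := hS j (-1) (by simp)
      rw [hd, shear_EE] at this
      rw [ang]
      simpa [sub_eq_add_neg] using this
  obtain ⟨T, hT, hTn⟩ := core_upper d h n hn3 hodd hh hA hB1 (hB X)
  apply le_antisymm
  · refine le_trans (csInf_le ?_ ⟨T, hT, rfl⟩) hTn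
    refine ⟨Real.sin h, ?_⟩
    rintro r ⟨T', hT', rfl⟩
    exact core_lower d h n hn3 hh hA hB1 (hB X) T' hT'
  · refine le_csInf ⟨nrad T, T, hT, rfl⟩ ?_
    rintro r ⟨T', hT', rfl⟩
    exact core_lower d h n hn3 hh hA hB1 (hB X) T' hT'
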